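/- (Spherical case.) Let γ(t) = Ψ(u(t), v(t)) be a nondegenerate curve on [a,b] with sinh(u(t)) > 0 and sinh(u(t)) + λ ≠ 0 for all t ∈ [a,b]. Then γ is a critical point of the energy with density ρ(u,v) = sinh(u) + λ (i.e. a catenary with respect to the spacelike plane {z = 0}) if and only if its geodesic curvature satisfies κ(t) = − v'(t) cosh(u(t))² / ( (sinh(u(t)) + λ) · |γ'(t)| ) for all t ∈ [a,b]. -/

import Mathlib

noncomputable section

open Real

/-- Lorentzian inner product on `ℝ³`: `⟨p,q⟩ = p₁q₁ + p₂q₂ − p₃q₃`. -/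
def lprod (p q : Fin 3 → ℝ) : ℝ := p 0 * q 0 + p 1 * q 1 - p 2 * q 2

/-- Determinant of the 3×3 matrix with rows `a`, `b`, `c`. -/
def det3 (a b c : Fin 3 → ℝ) : ℝ :=
  a 0 * (b 1 * c 2 - b 2 * c 1) - a 1 * (b 0 * c 2 - b 2 * c 0)
    + a 2 * (b 0 * c 1 - b 1 * c 0)

/-- Parametrization `Ψ` of the de Sitter plane `S₁² ⊂ L³`. -/
def Psi (u v : ℝ) : Fin 3 → ℝ :=
  ![Real.cosh u * Real.cos v, Real.cosh u * Real.sin v, Real.sinh u]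

/-- The curve `t ↦ Ψ(u t, v t)`, restricted to `[a, b]`, is a critical point of the
energy `E[γ] = ∫ₐᵇ ρ(u(t), v(t)) |γ'(t)| dt` among variations fixing the endpoints. -/
def IsCritical (ρ : ℝ → ℝ → ℝ) (ε : ℝ) (u v : ℝ → ℝ) (a b : ℝ) : Prop :=
  ∀ φ ψ : ℝ → ℝ, ContDiff ℝ (⊤ : ℕ∞) φ → ContDiff ℝ (⊤ : ℕ∞) ψ →
    φ a = 0 → φ b = 0 → ψ a = 0 → ψ b = 0 →
    deriv (fun s : ℝ => ∫ t in a..b,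
      ρ (u t + s * φ t) (v t + s * ψ t) *
        Real.sqrt (ε * ((deriv v t + s * deriv ψ t) ^ 2 *
          Real.cosh (u t + s * φ t) ^ 2 - (deriv u t + s * deriv φ t) ^ 2))) 0 = 0

open MeasureTheory in
/-- Differentiation under the integral sign over a compact interval, for an integrand whose
derivative in the parameter is jointly continuous near the base parameter. -/
lemma hasDerivAt_intervalIntegral_of_continuousOn {F F' : ℝ → ℝ → ℝ} {a b δ : ℝ} (hab : a ≤ b)
    (hδ : 0 < δ) (hF : Continuous fun x : ℝ × ℝ => F x.1 x.2)
    (hF' : ContinuousOn (fun x : ℝ × ℝ => F' x.1 x.2) (Set.Icc (-δ) δ ×ˢ Set.Icc a b))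
    (hd : ∀ s ∈ Set.Icc (-δ) δ, ∀ t ∈ Set.Icc a b, HasDerivAt (fun r => F r t) (F' s t) s) :
    HasDerivAt (fun s => ∫ t in a..b, F s t) (∫ t in a..b, F' 0 t) 0 := by
  have hsub : Set.uIoc a b ⊆ Set.Icc a b := by
    rw [Set.uIoc_of_le hab]; exact Set.Ioc_subset_Icc_self
  obtain ⟨C, hC⟩ := (isCompact_Icc.prod isCompact_Icc).exists_bound_of_continuousOn hF'
  have hcont : ∀ s, Continuous (F s) := fun s =>
    hF.comp (continuous_const.prodMk continuous_id)
  have hcont' : ContinuousOn (F' 0) (Set.Icc a b) :=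
    hF'.comp (f := fun t : ℝ => ((0 : ℝ), t)) (by fun_prop)
      fun t ht => ⟨⟨neg_nonpos.2 hδ.le, hδ.le⟩, ht⟩
  refine (intervalIntegral.hasDerivAt_integral_of_dominated_loc_of_deriv_le
    (bound := fun _ => C) (Icc_mem_nhds (neg_lt_zero.2 hδ) hδ) ?_ ?_ ?_ ?_ ?_ ?_).2
  · exact Filter.Eventually.of_forall fun s => (hcont s).aestronglyMeasurable
  · exact (hcont 0).intervalIntegrable _ _
  · exact (hcont'.mono hsub).aestronglyMeasurable measurableSet_uIoc
  · exact Filter.Eventually.of_forall fun t ht s hs => hC (s, t) ⟨hs, hsub ht⟩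
  · exact intervalIntegrable_const
  · exact Filter.Eventually.of_forall fun t ht s hs => hd s hs t (hsub ht)

/-- A continuous function of two variables which is positive on `{0} × [a, b]` is positive on
`[-δ, δ] × [a, b]` for some `δ > 0`. -/
lemma exists_pos_on_Icc_prod {Q : ℝ → ℝ → ℝ} {a b : ℝ}
    (hQ : Continuous fun x : ℝ × ℝ => Q x.1 x.2) (hpos : ∀ t ∈ Set.Icc a b, 0 < Q 0 t) :
    ∃ δ > 0, ∀ s ∈ Set.Icc (-δ) δ, ∀ t ∈ Set.Icc a b, 0 < Q s t := by
  obtain ⟨U, V, hU, -, h0, hV, hUV⟩ := generalized_tube_lemma (isCompact_singleton (x := (0 : ℝ)))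
    (isCompact_Icc (a := a) (b := b)) (isOpen_lt continuous_const hQ)
    (by rintro ⟨s, t⟩ ⟨rfl, ht⟩; exact hpos t ht)
  obtain ⟨δ, hδ, hball⟩ := Metric.nhds_basis_closedBall.mem_iff.1 (hU.mem_nhds (h0 rfl))
  rw [Real.closedBall_eq_Icc, zero_sub, zero_add] at hball
  exact ⟨δ, hδ, fun s hs t ht => hUV (Set.mk_mem_prod (hball hs) (hV ht))⟩

/-- `det (γ, γ', γ'')` for `γ = Ψ(u, v)`, as a function of the 2-jets of `u` and `v`. -/
def detJet (u u₁ u₂ v₁ v₂ : ℝ) : ℝ :=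
  Real.cosh u * (v₁ * u₂ - u₁ * v₂) - 2 * u₁ ^ 2 * v₁ * Real.sinh u
    + v₁ ^ 3 * Real.sinh u * Real.cosh u ^ 2

lemma hasDerivAt_Psi {u v : ℝ → ℝ} {u' v' t : ℝ} (hu : HasDerivAt u u' t)
    (hv : HasDerivAt v v' t) :
    HasDerivAt (fun t => Psi (u t) (v t))
      ![Real.sinh (u t) * u' * Real.cos (v t) + Real.cosh (u t) * (-Real.sin (v t) * v'),
        Real.sinh (u t) * u' * Real.sin (v t) + Real.cosh (u t) * (Real.cos (v t) * v'),
        Real.cosh (u t) * u'] t := by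
  rw [hasDerivAt_pi]
  intro i
  fin_cases i
  · exact hu.cosh.mul hv.cos
  · exact hu.cosh.mul hv.sin
  · exact hu.sinh

lemma det3_Psi {u v u₁ v₁ u₂ v₂ : ℝ → ℝ} (hu : ∀ t, HasDerivAt u (u₁ t) t)
    (hv : ∀ t, HasDerivAt v (v₁ t) t) (hu₁ : ∀ t, HasDerivAt u₁ (u₂ t) t)
    (hv₁ : ∀ t, HasDerivAt v₁ (v₂ t) t) (t : ℝ) :
    det3 (Psi (u t) (v t)) (deriv (fun t => Psi (u t) (v t)) t)
      (deriv (deriv fun t => Psi (u t) (v t)) t) = detJet (u t) (u₁ t) (u₂ t) (v₁ t) (v₂ t) := by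
  have h1 := funext fun t => (hasDerivAt_Psi (hu t) (hv t)).deriv
  have h2 : HasDerivAt (deriv fun t => Psi (u t) (v t))
      ![(Real.cosh (u t) * u₁ t * u₁ t + Real.sinh (u t) * u₂ t) * Real.cos (v t)
          + Real.sinh (u t) * u₁ t * (-Real.sin (v t) * v₁ t)
          + (Real.sinh (u t) * u₁ t * (-Real.sin (v t) * v₁ t)
          + Real.cosh (u t) * (-(Real.cos (v t) * v₁ t) * v₁ t + -Real.sin (v t) * v₂ t)),
        (Real.cosh (u t) * u₁ t * u₁ t + Real.sinh (u t) * u₂ t) * Real.sin (v t)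
          + Real.sinh (u t) * u₁ t * (Real.cos (v t) * v₁ t)
          + (Real.sinh (u t) * u₁ t * (Real.cos (v t) * v₁ t)
          + Real.cosh (u t) * (-Real.sin (v t) * v₁ t * v₁ t + Real.cos (v t) * v₂ t)),
        Real.sinh (u t) * u₁ t * u₁ t + Real.cosh (u t) * u₂ t] t := by
    rw [h1, hasDerivAt_pi]
    intro i
    fin_cases i
    · exact (((hu t).sinh.mul (hu₁ t)).mul (hv t).cos).add
        ((hu t).cosh.mul ((hv t).sin.neg.mul (hv₁ t)))
    · exact (((hu t).sinh.mul (hu₁ t)).mul (hv t).sin).add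
        ((hu t).cosh.mul ((hv t).cos.mul (hv₁ t)))
    · exact (hu t).cosh.mul (hu₁ t)
  rw [h2.deriv, h1]
  simp only [det3, Psi, detJet, Matrix.cons_val_zero, Matrix.cons_val_one, Matrix.cons_val]
  have hc := Real.cosh_sq (u t)
  have hs := Real.sin_sq_add_cos_sq (v t)
  generalize Real.cosh (u t) = C at *
  generalize Real.sinh (u t) = S at *
  generalize Real.cos (v t) = c at *
  generalize Real.sin (v t) = s at *
  have hs' : s ^ 2 = 1 - c ^ 2 := by linarith
  have hS : S ^ 2 = C ^ 2 - 1 := by linarith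
  grind

/-- The numerator of the Euler–Lagrange expression of `∫ (sinh u + lam) |γ'|`. -/
def eulerJet (ε lam u u₁ u₂ v₁ v₂ : ℝ) : ℝ :=
  ε * (Real.sinh u + lam) * detJet u u₁ u₂ v₁ v₂
    + ε * (v₁ ^ 2 * Real.cosh u ^ 2 - u₁ ^ 2) * (v₁ * Real.cosh u ^ 2)

lemma sinh_add_mul_sqrt_hasDerivAt (ε lam u u₁ v₁ x x₁ y₁ s : ℝ)
    (hQ : 0 < ε * ((v₁ + s * y₁) ^ 2 * Real.cosh (u + s * x) ^ 2 - (u₁ + s * x₁) ^ 2)) :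
    HasDerivAt (fun s => (Real.sinh (u + s * x) + lam) *
        Real.sqrt (ε * ((v₁ + s * y₁) ^ 2 * Real.cosh (u + s * x) ^ 2 - (u₁ + s * x₁) ^ 2)))
      (Real.cosh (u + s * x) * x *
        Real.sqrt (ε * ((v₁ + s * y₁) ^ 2 * Real.cosh (u + s * x) ^ 2 - (u₁ + s * x₁) ^ 2)) +
        (Real.sinh (u + s * x) + lam) *
          (ε * ((v₁ + s * y₁) * y₁ * Real.cosh (u + s * x) ^ 2
            + (v₁ + s * y₁) ^ 2 * (Real.cosh (u + s * x) * Real.sinh (u + s * x) * x)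
            - (u₁ + s * x₁) * x₁)
          / Real.sqrt (ε * ((v₁ + s * y₁) ^ 2 * Real.cosh (u + s * x) ^ 2
            - (u₁ + s * x₁) ^ 2)))) s := by
  have hlin : ∀ c d : ℝ, HasDerivAt (fun s => c + s * d) d s := fun c d => by
    simpa using ((hasDerivAt_id s).mul_const d).const_add c
  have h := ((hlin u x).sinh.add_const lam).mul
    (((((hlin v₁ y₁).pow 2).mul ((hlin u x).cosh.pow 2)).sub
      ((hlin u₁ x₁).pow 2)).const_mul ε |>.sqrt hQ.ne')
  refine h.congr_deriv ?_
  simp only [Pi.pow_apply, Pi.mul_apply, Pi.sub_apply]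
  have := (Real.sqrt_pos.2 hQ).ne'
  field_simp
  push_cast
  ring

/-- First variation formula for the energy with density `sinh u + lam`. -/
lemma energy_hasDerivAt {a b lam ε : ℝ} (hab : a ≤ b) {u u₁ v₁ u₂ v₂ x x₁ y y₁ : ℝ → ℝ}
    (hu : ∀ t, HasDerivAt u (u₁ t) t)
    (hu₁ : ∀ t, HasDerivAt u₁ (u₂ t) t) (hv₁ : ∀ t, HasDerivAt v₁ (v₂ t) t)
    (hu₂ : Continuous u₂) (hv₂ : Continuous v₂)
    (hx : ∀ t, HasDerivAt x (x₁ t) t) (hy : ∀ t, HasDerivAt y (y₁ t) t)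
    (hx₁ : Continuous x₁) (hy₁ : Continuous y₁)
    (hxa : x a = 0) (hxb : x b = 0) (hya : y a = 0) (hyb : y b = 0)
    (hnd : ∀ t ∈ Set.Icc a b, 0 < ε * (v₁ t ^ 2 * Real.cosh (u t) ^ 2 - u₁ t ^ 2)) :
    HasDerivAt (fun s : ℝ => ∫ t in a..b, (Real.sinh (u t + s * x t) + lam) *
        Real.sqrt (ε * ((v₁ t + s * y₁ t) ^ 2 * Real.cosh (u t + s * x t) ^ 2
          - (u₁ t + s * x₁ t) ^ 2)))
      (∫ t in a..b, (x t * v₁ t - y t * u₁ t) * (ε * Real.cosh (u t))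
        * eulerJet ε lam (u t) (u₁ t) (u₂ t) (v₁ t) (v₂ t)
        / Real.sqrt (ε * (v₁ t ^ 2 * Real.cosh (u t) ^ 2 - u₁ t ^ 2)) ^ 3) 0 := by
  have cu : Continuous u := continuous_iff_continuousAt.2 fun t => (hu t).continuousAt
  have cu₁ : Continuous u₁ := continuous_iff_continuousAt.2 fun t => (hu₁ t).continuousAt
  have cv₁ : Continuous v₁ := continuous_iff_continuousAt.2 fun t => (hv₁ t).continuousAt
  have cx : Continuous x := continuous_iff_continuousAt.2 fun t => (hx t).continuousAt
  have cy : Continuous y := continuous_iff_continuousAt.2 fun t => (hy t).continuousAt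
  obtain ⟨δ, hδ, hpos⟩ := exists_pos_on_Icc_prod (a := a) (b := b)
    (Q := fun s t => ε * ((v₁ t + s * y₁ t) ^ 2 * Real.cosh (u t + s * x t) ^ 2
          - (u₁ t + s * x₁ t) ^ 2)) (by fun_prop) (by simpa using hnd)
  refine (hasDerivAt_intervalIntegral_of_continuousOn hab hδ ?_ ?_ fun s hs t ht =>
    sinh_add_mul_sqrt_hasDerivAt ε lam (u t) (u₁ t) (v₁ t) (x t) (x₁ t) (y₁ t) s
      (hpos s hs t ht)).congr_deriv ?_
  · fun_prop
  · refine ContinuousOn.add (by fun_prop) (ContinuousOn.mul (by fun_prop)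
      (ContinuousOn.div (by fun_prop) (by fun_prop) ?_))
    rintro ⟨s, t⟩ ⟨hs, ht⟩
    exact (Real.sqrt_pos.2 (hpos s hs t ht)).ne'
  simp only [zero_mul, add_zero]
  have hW : ∀ t ∈ Set.Icc a b,
      Real.sqrt (ε * (v₁ t ^ 2 * Real.cosh (u t) ^ 2 - u₁ t ^ 2)) ≠ 0 :=
    fun t ht => (Real.sqrt_pos.2 (hnd t ht)).ne'
  rw [← sub_eq_zero, ← intervalIntegral.integral_sub]
  rotate_left
  · refine ContinuousOn.intervalIntegrable_of_Icc hab (ContinuousOn.add (by fun_prop)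
      (ContinuousOn.mul (by fun_prop) (ContinuousOn.div (by fun_prop) (by fun_prop) hW)))
  · refine ContinuousOn.intervalIntegrable_of_Icc hab
      (ContinuousOn.div ?_ (by fun_prop) fun t ht => pow_ne_zero 3 (hW t ht))
    unfold eulerJet detJet
    fun_prop
  rw [intervalIntegral.integral_eq_sub_of_hasDerivAt
    (f := fun t => (Real.sinh (u t) + lam) * (ε * (v₁ t * Real.cosh (u t) ^ 2 * y t - u₁ t * x t))
      / Real.sqrt (ε * (v₁ t ^ 2 * Real.cosh (u t) ^ 2 - u₁ t ^ 2)))]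
  · simp [hxa, hxb, hya, hyb]
  · intro t ht
    rw [Set.uIcc_of_le hab] at ht
    have hQ := hnd t ht
    have h := (((hu t).sinh.add_const lam).mul
      (((((hv₁ t).mul ((hu t).cosh.pow 2)).mul (hy t)).sub ((hu₁ t).mul (hx t))).const_mul ε)).div
      ((((((hv₁ t).pow 2).mul ((hu t).cosh.pow 2)).sub
        ((hu₁ t).pow 2)).const_mul ε).sqrt hQ.ne') (hW t ht)
    refine h.congr_deriv ?_
    have hW' := hW t ht
    have hsq := Real.sq_sqrt hQ.le
    simp only [Pi.pow_apply, Pi.mul_apply, Pi.sub_apply, eulerJet, detJet] at hW' hsq ⊢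
    generalize Real.sqrt (ε * (v₁ t ^ 2 * Real.cosh (u t) ^ 2 - u₁ t ^ 2)) = W at *
    field_simp
    push_cast
    simp only [hsq]
    ring
  · refine ContinuousOn.intervalIntegrable_of_Icc hab (ContinuousOn.sub
      (ContinuousOn.add (by fun_prop)
      (ContinuousOn.mul (by fun_prop) (ContinuousOn.div (by fun_prop) (by fun_prop) hW)))
      (ContinuousOn.div ?_ (by fun_prop) fun t ht => pow_ne_zero 3 (hW t ht)))
    unfold eulerJet detJet
    fun_prop

theorem spherical_catenary_characterization
    (a b lam : ℝ) (hab : a < b)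
    (u v : ℝ → ℝ) (hu : ContDiff ℝ (⊤ : ℕ∞) u) (hv : ContDiff ℝ (⊤ : ℕ∞) v)
    (ε : ℝ) (hε : ε = 1 ∨ ε = -1)
    (γ : ℝ → Fin 3 → ℝ) (hγ : ∀ t, γ t = Psi (u t) (v t))
    (sp : ℝ → ℝ)
    (hsp : ∀ t, sp t =
      Real.sqrt (ε * ((deriv v t) ^ 2 * Real.cosh (u t) ^ 2 - (deriv u t) ^ 2)))
    (hnd : ∀ t ∈ Set.Icc a b,
      0 < ε * ((deriv v t) ^ 2 * Real.cosh (u t) ^ 2 - (deriv u t) ^ 2))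
    (κ : ℝ → ℝ)
    (hκ : ∀ t, κ t = ε * det3 (γ t) (deriv γ t) (deriv (deriv γ) t) / sp t ^ 3)
    (hd : ∀ t ∈ Set.Icc a b, 0 < Real.sinh (u t))
    (hne : ∀ t ∈ Set.Icc a b, Real.sinh (u t) + lam ≠ 0) :
    IsCritical (fun x _ => Real.sinh x + lam) ε u v a b ↔
      ∀ t ∈ Set.Icc a b,
        κ t = -(deriv v t * Real.cosh (u t) ^ 2) / ((Real.sinh (u t) + lam) * sp t) := by
  have smooth_deriv : ∀ f : ℝ → ℝ, ContDiff ℝ (⊤ : ℕ∞) f → ContDiff ℝ (⊤ : ℕ∞) (deriv f) :=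
    fun f hf => (contDiff_infty_iff_deriv.1 hf).2
  have has_deriv : ∀ f : ℝ → ℝ, ContDiff ℝ (⊤ : ℕ∞) f → ∀ t, HasDerivAt f (deriv f t) t :=
    fun f hf t => ((contDiff_infty_iff_deriv.1 hf).1 t).hasDerivAt
  have hu₁ := smooth_deriv u hu
  have hv₁ := smooth_deriv v hv
  have hu₂ := smooth_deriv _ hu₁
  have hv₂ := smooth_deriv _ hv₁
  have hε2 : ε ^ 2 = 1 := by rcases hε with rfl | rfl <;> norm_num
  set E : ℝ → ℝ := fun t => eulerJet ε lam (u t) (deriv u t) (deriv (deriv u) t) (deriv v t)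
    (deriv (deriv v) t) with hE
  have hEs : ContDiff ℝ (⊤ : ℕ∞) E := by
    simp only [hE, eulerJet, detJet]
    fun_prop
  have hcurv : ∀ t ∈ Set.Icc a b, (κ t = -(deriv v t * Real.cosh (u t) ^ 2)
      / ((Real.sinh (u t) + lam) * sp t) ↔ E t = 0) := by
    intro t ht
    have hW : sp t ≠ 0 := by rw [hsp]; exact (Real.sqrt_pos.2 (hnd t ht)).ne'
    have hsq : sp t ^ 2 =
        ε * (deriv v t ^ 2 * Real.cosh (u t) ^ 2 - deriv u t ^ 2) := by
      rw [hsp]; exact Real.sq_sqrt (hnd t ht).le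
    rw [hκ, funext hγ, det3_Psi (has_deriv u hu) (has_deriv v hv) (has_deriv _ hu₁)
      (has_deriv _ hv₁), div_eq_div_iff (pow_ne_zero 3 hW) (mul_ne_zero (hne t ht) hW),
      ← mul_eq_zero_iff_left hW, ← sub_eq_zero]
    refine Eq.congr ?_ rfl
    simp only [hE, eulerJet]
    linear_combination (sp t * (deriv v t * Real.cosh (u t) ^ 2)) * hsq
  have hvar : ∀ φ ψ : ℝ → ℝ, ContDiff ℝ (⊤ : ℕ∞) φ → ContDiff ℝ (⊤ : ℕ∞) ψ →
      φ a = 0 → φ b = 0 → ψ a = 0 → ψ b = 0 →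
      deriv (fun s : ℝ => ∫ t in a..b, (Real.sinh (u t + s * φ t) + lam) *
        Real.sqrt (ε * ((deriv v t + s * deriv ψ t) ^ 2 *
          Real.cosh (u t + s * φ t) ^ 2 - (deriv u t + s * deriv φ t) ^ 2))) 0
      = ∫ t in a..b, (φ t * deriv v t - ψ t * deriv u t) * (ε * Real.cosh (u t)) * E t
          / sp t ^ 3 := by
    intro φ ψ hφ hψ ha hb ha' hb'
    simp only [hsp]
    exact (energy_hasDerivAt hab.le (has_deriv u hu) (has_deriv _ hu₁) (has_deriv _ hv₁)
      hu₂.continuous hv₂.continuous (has_deriv φ hφ) (has_deriv ψ hψ)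
      (smooth_deriv φ hφ).continuous (smooth_deriv ψ hψ).continuous ha hb ha' hb' hnd).deriv
  rw [forall₂_congr hcurv]
  constructor
  · intro hcrit
    have hint : ∫ t in a..b, (t - a) * (b - t) * ((deriv v t ^ 2 + deriv u t ^ 2)
        * (Real.cosh (u t) * E t) ^ 2 / sp t ^ 3) = 0 := by
      have hφ : ContDiff ℝ (⊤ : ℕ∞) fun t =>
          (t - a) * (b - t) * (ε * Real.cosh (u t) * deriv v t * E t) := by fun_prop
      have hψ : ContDiff ℝ (⊤ : ℕ∞) fun t =>
          (t - a) * (b - t) * (-(ε * Real.cosh (u t) * deriv u t * E t)) := by fun_prop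
      rw [← hcrit _ _ hφ hψ (by simp) (by simp) (by simp) (by simp),
        hvar _ _ hφ hψ (by simp) (by simp) (by simp) (by simp)]
      refine intervalIntegral.integral_congr fun t _ => ?_
      linear_combination (-(t - a) * (b - t) * ((deriv v t ^ 2 + deriv u t ^ 2)
        * (Real.cosh (u t) * E t) ^ 2 / sp t ^ 3)) * hε2
    have hsp_pos : ∀ t ∈ Set.Icc a b, 0 < sp t := fun t ht => by
      rw [hsp]; exact Real.sqrt_pos.2 (hnd t ht)
    have hsp_cont : Continuous sp := by
      rw [funext hsp]; fun_prop
    have huc := hu.continuous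
    have hEc := hEs.continuous
    have hu₁c := hu₁.continuous
    have hv₁c := hv₁.continuous
    have hIoo : Set.EqOn E 0 (Set.Ioo a b) := by
      intro t ht
      by_contra hEt
      refine (intervalIntegral.integral_pos hab ?_ ?_ ⟨t, Set.Ioo_subset_Icc_self ht, ?_⟩).ne' hint
      · exact ContinuousOn.mul (by fun_prop) (ContinuousOn.div
          (Continuous.continuousOn (by fun_prop)) (by fun_prop)
          fun t ht => (pow_pos (hsp_pos t ht) 3).ne')
      · intro t ht
        have h1 := sub_nonneg.2 ht.1.le
        have h2 := sub_nonneg.2 ht.2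
        have h3 := hsp_pos t (Set.Ioc_subset_Icc_self ht)
        positivity
      · have h1 := sub_pos.2 ht.1
        have h2 := sub_pos.2 ht.2
        have h3 := hsp_pos t (Set.Ioo_subset_Icc_self ht)
        have h4 := Real.cosh_pos (u t)
        have h5 : 0 < deriv v t ^ 2 + deriv u t ^ 2 := by
          refine (by positivity : 0 ≤ deriv v t ^ 2 + deriv u t ^ 2).lt_of_ne' fun h0 => ?_
          have hv0 : deriv v t ^ 2 = 0 := by nlinarith [sq_nonneg (deriv v t), sq_nonneg (deriv u t)]
          have hu0 : deriv u t ^ 2 = 0 := by nlinarith [sq_nonneg (deriv v t), sq_nonneg (deriv u t)]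
          have := hnd t (Set.Ioo_subset_Icc_self ht)
          simp [hv0, hu0] at this
        have h6 : 0 < (Real.cosh (u t) * E t) ^ 2 := sq_pos_of_ne_zero (mul_ne_zero h4.ne' hEt)
        positivity
    have := hIoo.closure hEs.continuous continuous_const
    rwa [closure_Ioo hab.ne] at this
  · intro h φ ψ hφ hψ ha hb ha' hb'
    rw [hvar φ ψ hφ hψ ha hb ha' hb']
    refine intervalIntegral.integral_zero_ae (Filter.Eventually.of_forall fun t ht => ?_)
    rw [Set.uIoc_of_le hab.le] at ht
    have : E t = 0 := h t (Set.Ioc_subset_Icc_self ht)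
    simp [this]
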